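/- Let n ≥ 1 and let θ : ZMod n → ℝ satisfy θ i > 0 for all i. The following are equivalent: (a) there exist maps s : ZMod n → {−1, 1} with s (i+1) = −s i for all i, x : ZMod n → ℝ with x (i+1) = x i + s i · θ i for all i, and an injective L : ZMod n → ℝ satisfying conditions (i) and (ii) of a valid layering with respect to x; (b) n is even and ∑_{i=0}^{n−1} (−1)^i θ i = 0. -/

import Mathlib

/-- Mountain or valley fold type. -/
inductive MV
  | mountain
  | valley
deriving DecidableEq

/-- Designation of a face as interior or exterior. -/
inductive Des
  | interior
  | exterior
deriving DecidableEq

/-- The sign `ε` used at the top layer: `-1` for an interior face, `+1` for an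
exterior face. -/
def epsOf : Des → ℝ
  | Des.interior => -1
  | Des.exterior => 1

/-- The folded coordinates of a closed cycle: `x 0 = 0` and
`x (i+1) = x i + (-1)^i * θ i`. -/
noncomputable def foldedX (n : ℕ) (θ : ZMod n → ℝ) : ZMod n → ℝ :=
  fun i => ∑ j ∈ Finset.range i.val, (-1 : ℝ) ^ j * θ (j : ZMod n)

/-- `(n, θ)` is a closed cycle: `n` is even, `n ≥ 2`, all edge lengths are
positive, and the alternating sum of the edge lengths is zero. -/
noncomputable def IsClosedCycle (n : ℕ) (θ : ZMod n → ℝ) : Prop :=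
  Even n ∧ 2 ≤ n ∧ (∀ i, 0 < θ i) ∧
    ∑ j ∈ Finset.range n, (-1 : ℝ) ^ j * θ (j : ZMod n) = 0

/-- The open interval whose endpoint set is `{a, b}`. -/
def betw (a b : ℝ) : Set ℝ := Set.Ioo (min a b) (max a b)

/-- `L` is a valid layering of the edges of a cycle folded to coordinates `x`:
`L` is injective; (i) no edge passes strictly between the two edges joined at a
crease at the crease's coordinate; (ii) creases at the same coordinate opening in
the same direction are disjoint or nested. -/
def ValidLayering (n : ℕ) (x L : ZMod n → ℝ) : Prop :=
  Function.Injective L ∧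
  (∀ i e : ZMod n, x i ∈ betw (x e) (x (e + 1)) →
      L e ∉ betw (L (i - 1)) (L i)) ∧
  (∀ i j : ZMod n, i ≠ j → x i = x j →
      Real.sign (x (i + 1) - x i) = Real.sign (x (j + 1) - x j) →
      Disjoint (betw (L (i - 1)) (L i)) (betw (L (j - 1)) (L j)) ∨
        betw (L (i - 1)) (L i) ⊆ betw (L (j - 1)) (L j) ∨
        betw (L (j - 1)) (L j) ⊆ betw (L (i - 1)) (L i))

/-- The layering `L` realizes the MV assignment `μ` with top-layer sign `ε`:
taking `t` to be the index maximizing `L` and `s` the alternating `±1` map with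
`s t = ε`, each crease `i` is a valley iff `s (i-1)` equals the sign of
`L i - L (i-1)`. -/
def Realizes (n : ℕ) (L : ZMod n → ℝ) (μ : ZMod n → MV) (ε : ℝ) : Prop :=
  ∃ t : ZMod n, (∀ j, L j ≤ L t) ∧
    ∃ s : ZMod n → ℝ, (∀ i, s i = 1 ∨ s i = -1) ∧ (∀ i, s (i + 1) = -s i) ∧
      s t = ε ∧
      ∀ i, μ i = MV.valley ↔ s (i - 1) = Real.sign (L i - L (i - 1))

/-- The MV assignment `μ` on the closed cycle `(n, θ)` is flat foldable as a
face with designation `d`: some valid layering of the folded cycle realizes it. -/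
noncomputable def FlatFoldable (n : ℕ) (θ : ZMod n → ℝ) (μ : ZMod n → MV)
    (d : Des) : Prop :=
  ∃ L : ZMod n → ℝ, ValidLayering n (foldedX n θ) L ∧ Realizes n L μ (epsOf d)

/-- The folded diameter of a closed cycle: `max x - min x` over the folded
coordinates. -/
noncomputable def foldedDiameter (n : ℕ) [NeZero n] (θ : ZMod n → ℝ) : ℝ :=
  Finset.univ.sup' ⟨0, Finset.mem_univ 0⟩ (foldedX n θ) -
    Finset.univ.inf' ⟨0, Finset.mem_univ 0⟩ (foldedX n θ)

theorem kj_val_succ (n : ℕ) [NeZero n] (i : ZMod n) :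
    (i.val + 1 < n ∧ (i + 1).val = i.val + 1) ∨ (i.val + 1 = n ∧ (i + 1).val = 0) := by
  have h := ZMod.val_lt i
  have e : i + 1 = ((i.val + 1 : ℕ) : ZMod n) := by
    push_cast
    rw [ZMod.natCast_zmod_val]
  rcases Nat.lt_or_ge (i.val + 1) n with h1 | h1
  · left
    refine ⟨h1, ?_⟩
    rw [e, ZMod.val_natCast, Nat.mod_eq_of_lt h1]
  · right
    have h2 : i.val + 1 = n := by omega
    refine ⟨h2, ?_⟩
    rw [e, ZMod.val_natCast, h2, Nat.mod_self]

theorem kj_val_pred (n : ℕ) [NeZero n] (a : ZMod n) (ha : a ≠ 0) :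
    (a - 1).val + 1 = a.val := by
  have h := kj_val_succ n (a - 1)
  rw [sub_add_cancel] at h
  rcases h with h | h
  · exact h.2.symm
  · exact absurd ((ZMod.val_eq_zero a).1 h.2) ha

theorem kj_layer (n : ℕ) [NeZero n] (x : ZMod n → ℝ) (m : ZMod n) (hm : ∀ i, x m ≤ x i) :
    ValidLayering n x (fun e => ((e - m).val : ℝ)) := by
  have hpred : ∀ i, i ≠ m → betw (((i - 1 - m).val : ℝ)) ((i - m).val : ℝ)
      = Set.Ioo ((i - m).val - 1 : ℝ) ((i - m).val : ℝ) := by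
    intro i hi
    have h := kj_val_pred n (i - m) (sub_ne_zero.2 hi)
    have e : i - 1 - m = i - m - 1 := by ring
    have h' : ((i - m - 1).val : ℝ) = (i - m).val - 1 := by
      rw [← h]; push_cast; ring
    rw [e, h', betw, min_eq_left (by linarith), max_eq_right (by linarith)]
  have hm0 : betw (((m - 1 - m).val : ℝ)) ((m - m).val : ℝ)
      = Set.Ioo (0 : ℝ) (n - 1) := by
    have h := kj_val_succ n (m - 1 - m)
    have e : m - 1 - m + 1 = 0 := by ring
    rw [e, ZMod.val_zero] at h
    have h1 : (m - 1 - m).val + 1 = n := by omega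
    have h' : ((m - 1 - m).val : ℝ) = n - 1 := by
      have h2 : ((m - 1 - m).val : ℝ) + 1 = n := by exact_mod_cast h1
      linarith
    have h0 : (0 : ℝ) ≤ ((m - 1 - m).val : ℝ) := Nat.cast_nonneg _
    rw [sub_self m, ZMod.val_zero, Nat.cast_zero, betw, min_eq_right h0, max_eq_left h0, h']
  have hsub : ∀ i, i ≠ m → Set.Ioo ((i - m).val - 1 : ℝ) ((i - m).val : ℝ) ⊆
      Set.Ioo (0 : ℝ) (n - 1) := by
    intro i hi
    have h := kj_val_pred n (i - m) (sub_ne_zero.2 hi)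
    have h1 : (1 : ℝ) ≤ ((i - m).val : ℝ) := by exact_mod_cast (by omega)
    have h2 : ((i - m).val : ℝ) + 1 ≤ n := by exact_mod_cast ZMod.val_lt (i - m)
    exact Set.Ioo_subset_Ioo (by linarith) (by linarith)
  refine ⟨?_, ?_, ?_⟩
  · intro a b h
    have h1 : (a - m).val = (b - m).val := Nat.cast_injective (R := ℝ) h
    exact sub_left_injective (ZMod.val_injective n h1)
  · intro i e hx
    by_cases hi : i = m
    · subst hi
      have := hx.1
      rcases min_choice (x e) (x (e + 1)) with h | h <;> rw [h] at this
      · exact absurd (hm e) (not_le.2 this)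
      · exact absurd (hm (e + 1)) (not_le.2 this)
    · show ((e - m).val : ℝ) ∉ betw _ _
      rw [hpred i hi]
      rintro ⟨h1, h2⟩
      have h3 : (e - m).val < (i - m).val := by exact_mod_cast h2
      have h4 : (i - m).val < (e - m).val + 1 := by
        have : ((i - m).val : ℝ) < (e - m).val + 1 := by linarith
        exact_mod_cast this
      omega
  · intro i j hij _ _
    simp only
    by_cases hi : i = m
    · subst hi
      right; right
      rw [hm0, hpred j (Ne.symm hij)]
      exact hsub j (Ne.symm hij)
    · by_cases hj : j = m
      · subst hj
        right; left
        rw [hm0, hpred i hi]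
        exact hsub i hi
      · left
        rw [hpred i hi, hpred j hj, Set.disjoint_left]
        rintro y ⟨h1, h2⟩ ⟨h3, h4⟩
        have h5 : (i - m).val < (j - m).val + 1 := by
          have : ((i - m).val : ℝ) < (j - m).val + 1 := by linarith
          exact_mod_cast this
        have h6 : (j - m).val < (i - m).val + 1 := by
          have : ((j - m).val : ℝ) < (i - m).val + 1 := by linarith
          exact_mod_cast this
        have h7 : (i - m).val = (j - m).val := by omega
        exact hij (sub_left_injective (ZMod.val_injective n h7))

/-- Justin–Kawasaki characterization for a single cycle with no flat angles:
a flat folding (alternating directions `s`, coordinates `x`, and a valid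
layering `L`) exists iff `n` is even and the alternating sum of the edge
lengths is zero. -/
theorem kawasaki_justin (n : ℕ) (hn : 1 ≤ n) (θ : ZMod n → ℝ)
    (hθ : ∀ i, 0 < θ i) :
    (∃ (s x L : ZMod n → ℝ),
        (∀ i, s i = 1 ∨ s i = -1) ∧ (∀ i, s (i + 1) = -s i) ∧
        (∀ i, x (i + 1) = x i + s i * θ i) ∧
        ValidLayering n x L) ↔
      (Even n ∧ ∑ i ∈ Finset.range n, (-1 : ℝ) ^ i * θ (i : ZMod n) = 0) := by
  haveI : NeZero n := ⟨by omega⟩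
  constructor
  · rintro ⟨s, x, L, hs, halt, hx, -⟩
    have hpow : ∀ k : ℕ, s (k : ZMod n) = (-1) ^ k * s 0 := by
      intro k
      induction k with
      | zero => simp
      | succ k ih => rw [Nat.cast_succ, halt, ih]; ring
    have hs0 : s 0 ≠ 0 := by
      rcases hs 0 with h | h <;> rw [h] <;> norm_num
    have hsum : ∀ k : ℕ, x (k : ZMod n) = x 0 +
        s 0 * ∑ i ∈ Finset.range k, (-1 : ℝ) ^ i * θ (i : ZMod n) := by
      intro k
      induction k with
      | zero => simp
      | succ k ih => rw [Nat.cast_succ, hx, ih, hpow, Finset.sum_range_succ]; ring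
    constructor
    · by_contra h
      have h1 := hpow n
      rw [(Nat.not_even_iff_odd.1 h).neg_one_pow, ZMod.natCast_self] at h1
      exact hs0 (by linarith)
    · have h1 := hsum n
      rw [ZMod.natCast_self] at h1
      have h2 : s 0 * ∑ i ∈ Finset.range n, (-1 : ℝ) ^ i * θ (i : ZMod n) = 0 := by linarith
      exact (mul_eq_zero.1 h2).resolve_left hs0
  · rintro ⟨hev, hsum⟩
    obtain ⟨m, hm⟩ := Finite.exists_min (foldedX n θ)
    refine ⟨fun i => (-1) ^ i.val, foldedX n θ, _, fun i => neg_one_pow_eq_or ℝ _, ?_, ?_,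
      kj_layer n _ m hm⟩
    · intro i
      simp only
      rcases kj_val_succ n i with ⟨_, h⟩ | ⟨h1, h⟩
      · rw [h, pow_succ]; ring
      · have h2 : (-1 : ℝ) ^ (i.val + 1) = 1 := by rw [h1]; exact hev.neg_one_pow
        rw [pow_succ] at h2
        rw [h, pow_zero]; linarith
    · intro i
      have key : ∑ j ∈ Finset.range (i.val + 1), (-1 : ℝ) ^ j * θ (j : ZMod n)
          = foldedX n θ i + (-1) ^ i.val * θ i := by
        rw [Finset.sum_range_succ, ZMod.natCast_zmod_val]; rfl
      rw [← key]
      rcases kj_val_succ n i with ⟨_, h⟩ | ⟨h1, h⟩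
      · unfold foldedX; rw [h]
      · rw [h1, hsum]; unfold foldedX; rw [h]; simp
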